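/- For every sufficiently large n, τ_E(T_n) ≤ (1/2)·C(n−1,2) + 2·log₂ n + 1, where C(n−1,2) = (n−1)(n−2)/2; that is, Enforcer has a strategy guaranteeing that, against every Avoider strategy, the graph formed by Avoider's claimed edges is connected and spanning on all n vertices by the end of Avoider's ⌈(1/2)·C(n−1,2) + 2·log₂ n + 1⌉-th move. -/

import Mathlib

/-- An edge of the complete graph `K_n` on vertex set `Fin n`:
a non-diagonal element of `Sym2 (Fin n)`. -/
abbrev Edge (n : ℕ) := {e : Sym2 (Fin n) // ¬ e.IsDiag}

/-- A position in the game: the pair (edges claimed by Avoider, edges claimed by Enforcer). -/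
abbrev Position (n : ℕ) := Finset (Edge n) × Finset (Edge n)

/-- A strategy assigns to each position an edge to claim. -/
abbrev Strategy (n : ℕ) := Position n → Edge n

/-- A strategy is legal if, whenever some edge is still unclaimed,
it selects a previously unclaimed edge. -/
def Legal (n : ℕ) (s : Strategy n) : Prop :=
  ∀ p : Position n, p.1 ∪ p.2 ≠ Finset.univ → s p ∉ p.1 ∪ p.2

/-- The position after `t` full rounds, Avoider moving first in each round. -/
def play (n : ℕ) (sA sE : Strategy n) : ℕ → Position n
  | 0 => (∅, ∅)
  | t + 1 =>
    let p := play n sA sE t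
    let a : Finset (Edge n) := insert (sA p) p.1
    (a, insert (sE (a, p.2)) p.2)

/-- Enforcer can force Avoider's claimed edge set to contain a losing set of `F`
by the end of Avoider's `t`-th move. -/
def EnforcerWinsBy (n : ℕ) (F : Set (Finset (Edge n))) (t : ℕ) : Prop :=
  ∃ sE : Strategy n, Legal n sE ∧ ∀ sA : Strategy n, Legal n sA →
    ∃ L ∈ F, L ⊆ (play n sA sE t).1

/-- The minimum number of moves Enforcer needs to win the Avoider–Enforcer game on `F`;
`⊤` if Enforcer cannot win. -/
noncomputable def tauE (n : ℕ) (F : Set (Finset (Edge n))) : ℕ∞ :=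
  sInf ((fun t : ℕ => (t : ℕ∞)) '' {t : ℕ | EnforcerWinsBy n F t})

/-- The simple graph on `Fin n` whose edges are the elements of `E`. -/
def toGraph (n : ℕ) (E : Finset (Edge n)) : SimpleGraph (Fin n) :=
  SimpleGraph.fromEdgeSet (Subtype.val '' (E : Set (Edge n)))

/-- `T_n`: the family of edge sets of connected spanning graphs on `Fin n`. -/
def Tfam (n : ℕ) : Set (Finset (Edge n)) :=
  {E | (toGraph n E).Connected}

section Connectivity

open Finset

open Classical in
/-- The vertices not covered by any edge of `A`. -/
noncomputable def isolated {n : ℕ} (A : Finset (Edge n)) : Finset (Fin n) :=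
  {v | ∀ e ∈ A, v ∉ e.1}

open Classical in
/-- The degree of `v` in the graph with edge set `E`. -/
noncomputable def edgeDegree {n : ℕ} (E : Finset (Edge n)) (v : Fin n) : ℕ :=
  #{e ∈ E | v ∈ e.1}

/-- Both endpoints of `e` lie in the same component of the graph with edge set `A`. -/
def Internal {n : ℕ} (A : Finset (Edge n)) (e : Edge n) : Prop :=
  ∀ u ∈ e.1, ∀ w ∈ e.1, (toGraph n A).Reachable u w

open Classical in
/-- The number of edges of `E` joining different components of the graph with edge set `A`. -/
noncomputable def crossCount {n : ℕ} (A E : Finset (Edge n)) : ℕ :=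
  #{e ∈ E | ¬ Internal A e}

/-- The number of components of the graph with edge set `A`. -/
noncomputable def componentCount {n : ℕ} (A : Finset (Edge n)) : ℕ :=
  Nat.card (toGraph n A).ConnectedComponent

/-- The exponential potential of Enforcer's degrees at the vertices isolated in Avoider's graph. -/
noncomputable def potential {n : ℕ} (A E : Finset (Edge n)) : ℕ :=
  ∑ v ∈ isolated A, 2 ^ edgeDegree E v

/-- The invariant that Enforcer maintains after each move of Avoider. -/
structure Invariant {n : ℕ} (p : Position n) : Prop where
  disjoint : Disjoint p.1 p.2
  card_eq : #p.1 = #p.2 + 1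
  potential_le : potential p.1 p.2 ≤ n
  crossCount_lt : crossCount p.1 p.2 + componentCount p.1 < n

variable {n : ℕ} {A B E : Finset (Edge n)} {a e : Edge n} {u v w : Fin n}

lemma mem_isolated : v ∈ isolated A ↔ ∀ e ∈ A, v ∉ e.1 := by
  simp [isolated]

lemma toGraph_adj : (toGraph n A).Adj u w ↔ ∃ e ∈ A, e.1 = s(u, w) := by
  simp only [toGraph, SimpleGraph.fromEdgeSet_adj, Set.mem_image, Finset.mem_coe,
    and_iff_left_iff_imp]
  rintro ⟨e, -, he⟩ rfl
  exact e.2 (by simp [he])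

lemma toGraph_mono (h : A ⊆ B) : toGraph n A ≤ toGraph n B :=
  SimpleGraph.fromEdgeSet_mono (Set.image_mono (Finset.coe_subset.2 h))

lemma isolated_anti (h : A ⊆ B) : isolated B ⊆ isolated A := fun _ hv ↦
  mem_isolated.2 fun e he ↦ mem_isolated.1 hv e (h he)

lemma Internal.mono (h : A ⊆ B) (he : Internal A e) : Internal B e := fun u hu w hw ↦
  (he u hu w hw).mono (toGraph_mono h)

lemma Internal.notMem_isolated (he : Internal A e) (hv : v ∈ e.1) : v ∉ isolated A := by
  intro hiso
  obtain ⟨w, hw⟩ := hv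
  have hne : v ≠ w := fun h ↦ e.2 (by simp [hw, h])
  obtain ⟨x⟩ := he v (by simp [hw]) w (by simp [hw])
  obtain ⟨y, hy⟩ : ∃ y, (toGraph n A).Adj v y := by
    cases x with
    | nil => exact absurd rfl hne
    | cons h _ => exact ⟨_, h⟩
  obtain ⟨f, hf, hfe⟩ := toGraph_adj.1 hy
  exact mem_isolated.1 hiso f hf (by simp [hfe])

lemma crossCount_anti_left (h : A ⊆ B) : crossCount B E ≤ crossCount A E := by
  classical
  refine Finset.card_le_card fun e he ↦ ?_
  rw [Finset.mem_filter] at he ⊢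
  exact ⟨he.1, fun h' ↦ he.2 (h'.mono h)⟩

lemma crossCount_insert_le : crossCount A (insert e E) ≤ crossCount A E + 1 := by
  classical
  rw [crossCount, crossCount, Finset.filter_insert]
  split_ifs
  · exact Nat.le_succ _
  · exact Finset.card_insert_le _ _

lemma crossCount_insert_of_internal (he : Internal A e) :
    crossCount A (insert e E) = crossCount A E := by
  classical
  rw [crossCount, crossCount, Finset.filter_insert, if_neg (not_not.2 he)]

lemma componentCount_anti (h : A ⊆ B) : componentCount B ≤ componentCount A :=
  Nat.card_le_card_of_surjective _
    (SimpleGraph.ConnectedComponent.surjective_map_ofLE (toGraph_mono h))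

lemma componentCount_insert_lt (ha : ¬ Internal A a) :
    componentCount (insert a A) < componentCount A := by
  classical
  have := Fintype.ofFinite (toGraph n A).ConnectedComponent
  have := Fintype.ofFinite (toGraph n (insert a A)).ConnectedComponent
  rw [componentCount, componentCount, Nat.card_eq_fintype_card, Nat.card_eq_fintype_card]
  have hle := toGraph_mono (Finset.subset_insert a A)
  refine Fintype.card_lt_of_surjective_not_injective _
    (SimpleGraph.ConnectedComponent.surjective_map_ofLE hle) fun hinj ↦ ha fun u hu w hw ↦ ?_
  rcases eq_or_ne u w with rfl | hne
  · exact SimpleGraph.Reachable.refl _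
  refine SimpleGraph.ConnectedComponent.exact (hinj (SimpleGraph.ConnectedComponent.sound ?_))
  refine SimpleGraph.Adj.reachable (toGraph_adj.2 ⟨a, Finset.mem_insert_self _ _, ?_⟩)
  exact (Sym2.mem_and_mem_iff hne).1 ⟨hu, hw⟩

lemma edgeDegree_insert_of_notMem (h : v ∉ e.1) : edgeDegree (insert e E) v = edgeDegree E v := by
  classical
  rw [edgeDegree, edgeDegree, Finset.filter_insert, if_neg h]

lemma edgeDegree_insert_le : edgeDegree (insert e E) v ≤ edgeDegree E v + 1 := by
  classical
  rw [edgeDegree, edgeDegree, Finset.filter_insert]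
  split_ifs
  · exact Finset.card_insert_le _ _
  · exact Nat.le_succ _

lemma edgeDegree_mono {F : Finset (Edge n)} (h : E ⊆ F) : edgeDegree E v ≤ edgeDegree F v :=
  Finset.card_le_card (Finset.filter_subset_filter _ h)

lemma potential_anti_left (h : A ⊆ B) : potential B E ≤ potential A E :=
  Finset.sum_le_sum_of_subset (isolated_anti h)

lemma potential_insert_of_forall_notMem (h : ∀ v ∈ e.1, v ∉ isolated A) :
    potential A (insert e E) = potential A E :=
  Finset.sum_congr rfl fun v hv ↦ by rw [edgeDegree_insert_of_notMem fun hve ↦ h v hve hv]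

open Classical in
/-- A cut that contains no edge of `A` consists of free edges and edges of `E`. -/
lemma card_mul_card_compl_le {S : Finset (Fin n)}
    (hS : ∀ u ∈ S, ∀ w ∉ S, ¬ (toGraph n A).Adj u w) :
    #S * #Sᶜ ≤ #(A ∪ E)ᶜ + #{e ∈ E | ∃ u ∈ S, ∃ w ∉ S, e.1 = s(u, w)} := by
  rw [← Finset.card_product]
  refine le_trans ?_ (Finset.card_union_le _ _)
  have hne : ∀ q ∈ S ×ˢ Sᶜ, q.1 ≠ q.2 := by
    intro q hq h
    rw [Finset.mem_product, Finset.mem_compl, h] at hq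
    exact hq.2 hq.1
  rw [← Finset.card_attach]
  refine Finset.card_le_card_of_injOn
    (fun q ↦ (⟨s(q.1.1, q.1.2), by simpa using hne q.1 q.2⟩ : Edge n)) ?_ ?_
  · rintro ⟨⟨u, w⟩, hq⟩ -
    obtain ⟨hu, hw⟩ : u ∈ S ∧ w ∉ S := by simpa using hq
    have hA : (⟨s(u, w), by simpa using hne _ hq⟩ : Edge n) ∉ A := fun h ↦
      hS u hu w hw (toGraph_adj.2 ⟨_, h, rfl⟩)
    by_cases hE : (⟨s(u, w), by simpa using hne _ hq⟩ : Edge n) ∈ E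
    · exact Finset.mem_union_right _ (Finset.mem_filter.2 ⟨hE, u, hu, w, hw, rfl⟩)
    · exact Finset.mem_union_left _ (by simp [hA, hE])
  · rintro ⟨⟨u, w⟩, hq⟩ - ⟨⟨u', w'⟩, hq'⟩ - h
    simp only [Finset.mem_product, Finset.mem_compl] at hq hq'
    simp only [Subtype.mk.injEq, Sym2.eq_iff] at h
    rcases h with ⟨rfl, rfl⟩ | ⟨rfl, rfl⟩
    · rfl
    · exact absurd hq.1 hq'.2

lemma edgeDegree_le_log (hp : potential A E ≤ n) (hv : v ∈ isolated A) :
    edgeDegree E v ≤ Nat.log 2 n := by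
  have h : 2 ^ edgeDegree E v ≤ n :=
    (Finset.single_le_sum (f := fun v ↦ 2 ^ edgeDegree E v) (fun _ _ ↦ Nat.zero_le _) hv).trans hp
  exact Nat.le_log_of_pow_le one_lt_two h

/-- While Avoider's graph is disconnected, the invariant leaves many edges free. -/
lemma Invariant.le_card_free (hn : 2 ≤ n) {p : Position n} (hp : Invariant p)
    (hc : ¬ (toGraph n p.1).Connected) :
    n ≤ #(p.1 ∪ p.2)ᶜ + 2 + Nat.log 2 n := by
  classical
  have hlog : 1 ≤ Nat.log 2 n := Nat.log_pos one_lt_two hn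
  by_cases hiso : ∃ v, v ∈ isolated p.1
  · obtain ⟨v, hv⟩ := hiso
    have hcut := card_mul_card_compl_le (A := p.1) (E := p.2) (S := {v}) (by
      intro u hu w _ h
      obtain ⟨e, he, hew⟩ := toGraph_adj.1 h
      rw [Finset.mem_singleton] at hu
      exact mem_isolated.1 hv e he (by simp [hew, hu]))
    have hdeg : #{e ∈ p.2 | ∃ u ∈ ({v} : Finset (Fin n)), ∃ w ∉ ({v} : Finset (Fin n)),
        e.1 = s(u, w)} ≤ edgeDegree p.2 v := by
      refine Finset.card_le_card fun e he ↦ ?_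
      rw [Finset.mem_filter] at he ⊢
      obtain ⟨he, u, hu, w, -, h⟩ := he
      rw [Finset.mem_singleton] at hu
      exact ⟨he, by simp [h, hu]⟩
    have := edgeDegree_le_log hp.potential_le hv
    rw [Finset.card_compl, Finset.card_singleton, Fintype.card_fin] at hcut
    lia
  · push Not at hiso
    have hnb : ∀ v, ∃ w, (toGraph n p.1).Adj v w := by
      intro v
      have hv := hiso v
      rw [mem_isolated] at hv
      push Not at hv
      obtain ⟨e, he, w, hw⟩ := hv
      exact ⟨w, toGraph_adj.2 ⟨e, he, hw⟩⟩
    have : Nonempty (Fin n) := ⟨⟨0, by lia⟩⟩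
    have hpre : ¬ (toGraph n p.1).Preconnected := fun h ↦ hc ⟨h⟩
    obtain ⟨x, y, hxy⟩ : ∃ x y, ¬ (toGraph n p.1).Reachable x y := by
      simpa [SimpleGraph.Preconnected] using hpre
    let S : Finset (Fin n) := {z | (toGraph n p.1).Reachable x z}
    have hmem : ∀ z, z ∈ S ↔ (toGraph n p.1).Reachable x z := by simp [S]
    have hcut := card_mul_card_compl_le (A := p.1) (E := p.2) (S := S) (by
      intro u hu w hw h
      rw [hmem] at hu hw
      exact hw (hu.trans h.reachable))
    have hcross : #{e ∈ p.2 | ∃ u ∈ S, ∃ w ∉ S, e.1 = s(u, w)} ≤ crossCount p.1 p.2 := by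
      refine Finset.card_le_card fun e he ↦ ?_
      rw [Finset.mem_filter] at he ⊢
      obtain ⟨he, u, hu, w, hw, h⟩ := he
      rw [hmem] at hu hw
      exact ⟨he, fun hint ↦ hw (hu.trans (hint u (by simp [h]) w (by simp [h])))⟩
    have h1 : 1 < #S := by
      obtain ⟨z, hz⟩ := hnb x
      exact Finset.one_lt_card.2
        ⟨x, (hmem _).2 (SimpleGraph.Reachable.refl _), z, (hmem _).2 hz.reachable, hz.ne⟩
    have h2 : 1 < #Sᶜ := by
      obtain ⟨z, hz⟩ := hnb y
      refine Finset.one_lt_card.2 ⟨y, ?_, z, ?_, hz.ne⟩ <;> rw [Finset.mem_compl, hmem]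
      · exact hxy
      · exact fun h ↦ hxy (h.trans hz.reachable.symm)
    have hsum : #S + #Sᶜ = n := by rw [Finset.card_add_card_compl, Fintype.card_fin]
    have := hp.crossCount_lt
    nlinarith

lemma Invariant.of_bounds {p : Position n} (hp : Invariant p) (he : e ∉ p.1 ∪ p.2)
    (ha : a ∉ p.1 ∪ insert e p.2)
    (hpot : potential (insert a p.1) (insert e p.2) ≤ n)
    (hcross : crossCount (insert a p.1) (insert e p.2) + componentCount (insert a p.1) < n) :
    Invariant (insert a p.1, insert e p.2) := by
  simp only [Finset.mem_union, not_or] at he ha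
  refine ⟨?_, ?_, hpot, hcross⟩
  · rw [Finset.disjoint_insert_left, Finset.disjoint_insert_right]
    exact ⟨ha.2, he.1, hp.disjoint⟩
  · rw [Finset.card_insert_of_notMem ha.1, Finset.card_insert_of_notMem he.2, hp.card_eq]

lemma crossCount_add_componentCount_lt {p : Position n} (hp : Invariant p)
    (ha : ¬ Internal p.1 a) :
    crossCount (insert a p.1) (insert e p.2) + componentCount (insert a p.1) < n := by
  have h1 := componentCount_insert_lt ha
  have h2 := crossCount_anti_left (E := insert e p.2) (Finset.subset_insert a p.1)
  have h3 := crossCount_insert_le (A := p.1) (e := e) (E := p.2)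
  have := hp.crossCount_lt
  lia

/-- A vertex of minimum degree among the isolated ones has a free edge to a covered vertex. -/
lemma Invariant.exists_free_edge (hn : 3 ≤ n) {p : Position n} (hp : Invariant p)
    (hv : v ∈ isolated p.1) (hmin : ∀ w ∈ isolated p.1, edgeDegree p.2 v ≤ edgeDegree p.2 w) :
    ∃ e ∉ p.1 ∪ p.2, ∃ w ∉ isolated p.1, e.1 = s(v, w) := by
  classical
  by_contra! hno
  have hne : ∀ w ∈ (isolated p.1)ᶜ, v ≠ w := by
    rintro w hw rfl
    exact Finset.mem_compl.1 hw hv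
  have hdeg : #(isolated p.1)ᶜ ≤ edgeDegree p.2 v := by
    rw [← Finset.card_attach]
    refine Finset.card_le_card_of_injOn
      (fun w ↦ (⟨s(v, w.1), by simpa using hne w.1 w.2⟩ : Edge n)) ?_ ?_
    · rintro ⟨w, hw⟩ -
      have hmem : (⟨s(v, w), by simpa using hne w hw⟩ : Edge n) ∈ p.1 ∪ p.2 := by
        by_contra h
        exact hno _ h w (Finset.mem_compl.1 hw) rfl
      refine Finset.mem_coe.2 (Finset.mem_filter.2 ⟨?_, by simp⟩)
      refine (Finset.mem_union.1 hmem).resolve_left fun h ↦ mem_isolated.1 hv _ h (by simp)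
    · rintro ⟨w, hw⟩ - ⟨w', hw'⟩ - h
      exact Subtype.ext (Sym2.congr_right.1 (Subtype.ext_iff.1 h))
  have hpos : 0 < #(isolated p.1)ᶜ := by
    obtain ⟨f, hf⟩ : p.1.Nonempty := Finset.card_pos.1 (by rw [hp.card_eq]; lia)
    obtain ⟨x, hx⟩ : ∃ x, x ∈ f.1 := by
      induction f.1 with | _ x y => exact ⟨x, by simp⟩
    exact Finset.card_pos.2 ⟨x, Finset.mem_compl.2 fun h ↦ mem_isolated.1 h f hf hx⟩
  have hu : 0 < #(isolated p.1) := Finset.card_pos.2 ⟨v, hv⟩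
  have hsum : #(isolated p.1) + #(isolated p.1)ᶜ = n := by
    rw [Finset.card_add_card_compl, Fintype.card_fin]
  have hpot : #(isolated p.1) * 2 ^ edgeDegree p.2 v ≤ n := by
    rw [← smul_eq_mul]
    exact (Finset.card_nsmul_le_sum _ _ _ fun w hw ↦
      Nat.pow_le_pow_right two_pos (hmin w hw)).trans hp.potential_le
  have hle := (Nat.mul_le_mul_left #(isolated p.1)
    (Nat.pow_le_pow_right two_pos hdeg)).trans hpot
  generalize #(isolated p.1)ᶜ = k at *
  generalize #(isolated p.1) = m at *
  obtain ⟨k, rfl⟩ : ∃ j, k = j + 1 := ⟨k - 1, by lia⟩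
  have hk : k < 2 ^ k := Nat.lt_two_pow_self
  rw [pow_succ] at hle
  nlinarith

/-- As long as Avoider's graph is disconnected, Enforcer has a move after which every reply of
Avoider restores the invariant. -/
lemma Invariant.exists_move (hn : 3 ≤ n) {p : Position n} (hp : Invariant p)
    (hfree : p.1 ∪ p.2 ≠ univ) :
    ∃ e ∉ p.1 ∪ p.2, ∀ a ∉ p.1 ∪ insert e p.2, Invariant (insert a p.1, insert e p.2) := by
  classical
  have hnot : ∀ {a e : Edge n}, a ∉ p.1 ∪ insert e p.2 → a ∉ p.1 ∪ p.2 := by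
    intro a e h
    simp only [Finset.mem_union, Finset.mem_insert, not_or] at h ⊢
    tauto
  by_cases hint : ∃ e ∉ p.1 ∪ p.2, Internal p.1 e
  · obtain ⟨e, he, hei⟩ := hint
    refine ⟨e, he, fun a ha ↦ hp.of_bounds he ha ?_ ?_⟩
    · refine (potential_anti_left (Finset.subset_insert _ _)).trans ?_
      rw [potential_insert_of_forall_notMem fun _ hv ↦ hei.notMem_isolated hv]
      exact hp.potential_le
    · have h1 := componentCount_anti (Finset.subset_insert a p.1)
      have h2 := crossCount_anti_left (E := insert e p.2) (Finset.subset_insert a p.1)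
      rw [crossCount_insert_of_internal hei] at h2
      have := hp.crossCount_lt
      lia
  push Not at hint
  by_cases hcov : ∃ e ∉ p.1 ∪ p.2, ∀ v ∈ e.1, v ∉ isolated p.1
  · obtain ⟨e, he, hec⟩ := hcov
    refine ⟨e, he, fun a ha ↦ hp.of_bounds he ha ?_
      (crossCount_add_componentCount_lt hp (hint a (hnot ha)))⟩
    refine (potential_anti_left (Finset.subset_insert _ _)).trans ?_
    rw [potential_insert_of_forall_notMem hec]
    exact hp.potential_le
  push Not at hcov
  obtain ⟨f, hf⟩ : ∃ f, f ∉ p.1 ∪ p.2 := by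
    by_contra! h
    exact hfree (Finset.eq_univ_iff_forall.2 h)
  obtain ⟨x, -, hx⟩ := hcov f hf
  obtain ⟨v, hv, hmin⟩ := Finset.exists_min_image _ (edgeDegree p.2) ⟨x, hx⟩
  obtain ⟨e, he, w, hw, hew⟩ := hp.exists_free_edge hn hv hmin
  refine ⟨e, he, fun a ha ↦ hp.of_bounds he ha ?_
    (crossCount_add_componentCount_lt hp (hint a (hnot ha)))⟩
  obtain ⟨z, hza, hz⟩ := hcov a (hnot ha)
  have hloss : potential (insert a p.1) (insert e p.2) + 2 ^ edgeDegree p.2 v ≤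
      potential p.1 (insert e p.2) := by
    rw [potential, potential, ← Finset.sum_erase_add _ _ hz]
    refine add_le_add (Finset.sum_le_sum_of_subset fun y hy ↦ Finset.mem_erase.2 ⟨?_, ?_⟩)
      (Nat.pow_le_pow_right two_pos
        ((hmin z hz).trans (edgeDegree_mono (Finset.subset_insert _ _))))
    · rintro rfl
      exact mem_isolated.1 hy a (Finset.mem_insert_self _ _) hza
    · exact isolated_anti (Finset.subset_insert _ _) hy
  have hgain : potential p.1 (insert e p.2) ≤ potential p.1 p.2 + 2 ^ edgeDegree p.2 v := by
    rw [potential, potential, ← Finset.sum_erase_add _ _ hv, ← Finset.sum_erase_add _ _ hv,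
      add_assoc]
    refine add_le_add (Finset.sum_le_sum fun y hy ↦ ?_) ?_
    · rw [Finset.mem_erase] at hy
      rw [edgeDegree_insert_of_notMem]
      rw [hew, Sym2.mem_iff]
      rintro (rfl | rfl)
      · exact hy.1 rfl
      · exact hw hy.2
    · rw [← two_mul, ← pow_succ']
      exact Nat.pow_le_pow_right two_pos edgeDegree_insert_le
  have := hp.potential_le
  lia

lemma invariant_singleton (a : Edge n) : Invariant (({a}, ∅) : Position n) := by
  classical
  refine ⟨by simp, by simp, ?_, ?_⟩
  · simpa [potential, edgeDegree] using Finset.card_le_univ (isolated {a})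
  · have hbot : toGraph n (∅ : Finset (Edge n)) = ⊥ := by simp [toGraph]
    have ha : ¬ Internal ∅ a := by
      intro h
      obtain ⟨x, hx⟩ : ∃ x, x ∈ a.1 := by
        induction a.1 with | _ x y => exact ⟨x, by simp⟩
      exact h.notMem_isolated hx (mem_isolated.2 (by simp))
    have h1 := componentCount_insert_lt ha
    have h2 : componentCount (∅ : Finset (Edge n)) ≤ n := by
      simpa [componentCount] using Nat.card_le_card_of_surjective
        (toGraph n (∅ : Finset (Edge n))).connectedComponentMk Quot.mk_surjective
    have h3 : crossCount ({a} : Finset (Edge n)) ∅ = 0 := by simp [crossCount]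
    rw [insert_empty_eq] at h1
    change crossCount ({a} : Finset (Edge n)) ∅ + componentCount ({a} : Finset (Edge n)) < n
    lia

/-- A legal Enforcer strategy that preserves the invariant. -/
lemma exists_legal_strategy (hn : 3 ≤ n) :
    ∃ sE : Strategy n, Legal n sE ∧ ∀ p : Position n, Invariant p → p.1 ∪ p.2 ≠ univ →
      ∀ a ∉ p.1 ∪ insert (sE p) p.2, Invariant (insert a p.1, insert (sE p) p.2) := by
  classical
  have key : ∀ p : Position n, ∃ e : Edge n, (p.1 ∪ p.2 ≠ univ → e ∉ p.1 ∪ p.2) ∧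
      (Invariant p → p.1 ∪ p.2 ≠ univ →
        ∀ a ∉ p.1 ∪ insert e p.2, Invariant (insert a p.1, insert e p.2)) := by
    intro p
    by_cases hfree : p.1 ∪ p.2 = univ
    · exact ⟨⟨s(⟨0, by lia⟩, ⟨1, by lia⟩), by simp⟩, by simp [hfree]⟩
    by_cases hp : Invariant p
    · obtain ⟨e, he, h⟩ := hp.exists_move hn hfree
      exact ⟨e, fun _ ↦ he, fun _ _ ↦ h⟩
    · obtain ⟨e, he⟩ : ∃ e, e ∉ p.1 ∪ p.2 := by
        by_contra! h
        exact hfree (Finset.eq_univ_iff_forall.2 h)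
      exact ⟨e, fun _ ↦ he, fun h ↦ absurd h hp⟩
  choose sE hlegal hinv using key
  exact ⟨sE, hlegal, hinv⟩

lemma log_two_add_four_le (hn : 8 ≤ n) : Nat.log 2 n + 4 ≤ n := by
  have : Nat.log 2 n < n - 3 := by
    refine Nat.log_lt_of_lt_pow (by lia) ?_
    obtain ⟨k, rfl⟩ := Nat.exists_eq_add_of_le hn
    have hk : k < 2 ^ k := Nat.lt_two_pow_self
    rw [show 8 + k - 3 = k + 5 by lia, pow_add]
    lia
  lia

/-- Enforcer can keep the invariant until Avoider's graph becomes connected. -/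
lemma connected_or_invariant_play (hn : 8 ≤ n) {sA sE : Strategy n} (hA : Legal n sA)
    (hE : Legal n sE)
    (hinv : ∀ p : Position n, Invariant p → p.1 ∪ p.2 ≠ univ →
      ∀ a ∉ p.1 ∪ insert (sE p) p.2, Invariant (insert a p.1, insert (sE p) p.2)) (t : ℕ) :
    (toGraph n (play n sA sE (t + 1)).1).Connected ∨
      Invariant ((play n sA sE (t + 1)).1, (play n sA sE t).2) ∧ #(play n sA sE t).2 = t := by
  induction t with
  | zero => exact Or.inr ⟨by simpa [play] using invariant_singleton _, by simp [play]⟩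
  | succ t ih =>
    rw [or_iff_not_imp_left]
    intro hc'
    have hsub : (play n sA sE (t + 1)).1 ⊆ (play n sA sE (t + 1 + 1)).1 :=
      Finset.subset_insert _ _
    have hc : ¬ (toGraph n (play n sA sE (t + 1)).1).Connected := fun h ↦
      hc' (h.mono (toGraph_mono hsub))
    obtain ⟨hp, ht⟩ := ih.resolve_left hc
    set q : Position n := ((play n sA sE (t + 1)).1, (play n sA sE t).2) with hq
    have hplay : play n sA sE (t + 1) = (q.1, insert (sE q) q.2) := rfl
    have hmany := hp.le_card_free (by lia) hc
    have hlog := log_two_add_four_le hn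
    have hfree : q.1 ∪ q.2 ≠ univ := by
      intro h
      rw [h, Finset.compl_univ, Finset.card_empty] at hmany
      lia
    have hnew : sE q ∉ q.1 ∪ q.2 := hE q hfree
    have hfree' : (play n sA sE (t + 1)).1 ∪ (play n sA sE (t + 1)).2 ≠ univ := by
      rw [hplay]
      intro h
      have hcard := Finset.card_insert_le (sE q) (q.1 ∪ q.2)
      rw [← Finset.union_insert, h] at hcard
      have := Finset.card_compl (q.1 ∪ q.2)
      rw [Finset.card_univ] at hcard
      lia
    have hmove := hA _ hfree'
    refine ⟨hinv q hp hfree (sA (play n sA sE (t + 1))) (by rw [hplay] at hmove ⊢; exact hmove), ?_⟩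
    rw [hplay]
    simp only [Finset.mem_union, not_or] at hnew
    rw [Finset.card_insert_of_notMem hnew.2]
    exact congrArg (· + 1) ht

lemma card_edge : Fintype.card (Edge n) = n.choose 2 := by
  simpa using Sym2.card_subtype_not_diag (α := Fin n)

lemma enforcerWinsBy_connected (hn : 8 ≤ n) {t : ℕ}
    (ht : ((n : ℝ) - 1) * ((n : ℝ) - 2) / 4 + 2 * Real.logb 2 n + 1 ≤ t) :
    EnforcerWinsBy n (Tfam n) t := by
  obtain ⟨sE, hE, hinv⟩ := exists_legal_strategy (n := n) (by lia)
  refine ⟨sE, hE, fun sA hA ↦ ⟨_, ?_, Finset.Subset.rfl⟩⟩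
  have hn' : (8 : ℝ) ≤ n := by exact_mod_cast hn
  have hlogpos : 0 < Real.logb 2 n := Real.logb_pos one_lt_two (by linarith)
  obtain ⟨s, rfl⟩ : ∃ s, t = s + 1 := by
    refine ⟨t - 1, (Nat.succ_pred_eq_of_pos ?_).symm⟩
    have : (0 : ℝ) < t := by nlinarith
    exact_mod_cast this
  by_contra hc
  obtain ⟨hp, hs⟩ := (connected_or_invariant_play hn hA hE hinv s).resolve_left hc
  have hmany := hp.le_card_free (by lia) hc
  have hcard := Finset.card_add_card_compl ((play n sA sE (s + 1)).1 ∪ (play n sA sE s).2)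
  have hA' := hp.card_eq
  rw [Finset.card_union_of_disjoint hp.disjoint, card_edge] at hcard
  simp only at hmany hcard hA'
  rw [hA', hs] at hcard
  have hlog : (Nat.log 2 n : ℝ) ≤ Real.logb 2 n := by
    simpa using Real.natLog_le_logb n 2
  have hcard' := congrArg (Nat.cast : ℕ → ℝ) hcard
  have hmany' : (n : ℝ) ≤ _ := Nat.cast_le.2 hmany
  rw [Nat.cast_choose_two] at hcard'
  push_cast at hcard' hmany' ht
  nlinarith

end Connectivity

/-- for every sufficiently large `n`,
`τ_E(T_n) ≤ (1/2)·C(n-1,2) + 2·log₂ n + 1`, i.e. Enforcer can force Avoider's graph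
to be connected and spanning by the end of Avoider's
`⌈(n-1)(n-2)/4 + 2·log₂ n + 1⌉`-th move. -/
theorem tauE_connectivity_upper :
    ∃ n₀ : ℕ, ∀ n : ℕ, n₀ ≤ n →
      tauE n (Tfam n) ≤
        ((⌈((n : ℝ) - 1) * ((n : ℝ) - 2) / 4 + 2 * Real.logb 2 n + 1⌉₊ : ℕ) : ℕ∞) := by
  refine ⟨8, fun n hn ↦ sInf_le ⟨_, ?_, rfl⟩⟩
  exact enforcerWinsBy_connected hn (Nat.le_ceil _)
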